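/- arXiv:1912.07676 — 2 statements merged into one kernel-verified Lean document; each statement's English description precedes it below -/
import Mathlib

section
/- Assume (A1)–(A8) and (A10) (γ_φ and γ_j are compact operators), let P : X → X* be a penalty operator for K, and let u ∈ K be the unique solution of the constrained variational-hemivariational inequality: ⟨A u, v − u⟩ + φ(γ_φ u, γ_φ v) − φ(γ_φ u, γ_φ u) + j⁰(γ_j u; γ_j v − γ_j u) ≥ ⟨f, v − u⟩ for all v ∈ K. Let (εₙ) be a sequence of positive numbers with εₙ → 0, and let (Vₙ) be a sequence of finite-dimensional linear subspaces of X satisfying (A9): for every v ∈ X there exist vₙ ∈ Vₙ with vₙ → v strongly in X, and for every v ∈ K there exist vₙ ∈ Vₙ ∩ K with vₙ → v strongly in X. For each n, let uₙ ∈ Vₙ satisfy ⟨A uₙ, vʰ − uₙ⟩ + (1/εₙ) ⟨P uₙ, vʰ − uₙ⟩ + φ(γ_φ uₙ, γ_φ vʰ) − φ(γ_φ uₙ, γ_φ uₙ) + j⁰(γ_j uₙ; γ_j vʰ − γ_j uₙ) ≥ ⟨f, vʰ − uₙ⟩ for all vʰ ∈ Vₙ. Then uₙ → u strongly in X as n →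 ∞. -/
open Filter Topology Bornology

/-- The generalized (Clarke) directional derivative of `ψ` at `x` in the direction `v`:
`ψ⁰(x; v) = limsup_{y → x, t ↓ 0} (ψ(y + t v) − ψ(y))/t`. -/
noncomputable def clarkeDeriv {Y : Type*} [NormedAddCommGroup Y] [NormedSpace ℝ Y]
    (ψ : Y → ℝ) (x v : Y) : ℝ :=
  Filter.limsup (fun p : Y × ℝ => (ψ (p.1 + p.2 • v) - ψ p.1) / p.2)
    ((𝓝 x) ×ˢ (𝓝[>] (0 : ℝ)))

/-- The generalized (Clarke) subdifferential:
`∂ψ(x) = {ζ ∈ Y* : ψ⁰(x; v) ≥ ⟨ζ, v⟩ for all v ∈ Y}`. -/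
def clarkeSubdiff {Y : Type*} [NormedAddCommGroup Y] [NormedSpace ℝ Y]
    (ψ : Y → ℝ) (x : Y) : Set (Y →L[ℝ] ℝ) :=
  {ζ | ∀ v : Y, ζ v ≤ clarkeDeriv ψ x v}

/-- Weak convergence of a sequence in a normed space: `⟨g, uₙ⟩ → ⟨g, u⟩` for all `g ∈ Y*`. -/
def WeakTendsto {Y : Type*} [NormedAddCommGroup Y] [NormedSpace ℝ Y]
    (u : ℕ → Y) (w : Y) : Prop :=
  ∀ g : Y →L[ℝ] ℝ, Tendsto (fun n => g (u n)) atTop (𝓝 (g w))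

/-- An operator `A : Y → Y*` is bounded if it maps bounded sets to bounded sets. -/
def BoundedOperator {Y : Type*} [NormedAddCommGroup Y] [NormedSpace ℝ Y]
    (A : Y → Y →L[ℝ] ℝ) : Prop :=
  ∀ s : Set Y, IsBounded s → IsBounded (A '' s)

/-- `A : Y → Y*` is pseudomonotone: it is bounded, and whenever `uₙ ⇀ u` weakly and
`limsupₙ ⟨A uₙ, uₙ − u⟩ ≤ 0`, one has
`⟨A u, u − v⟩ ≤ liminfₙ ⟨A uₙ, uₙ − v⟩` for all `v`. -/
def Pseudomonotone {Y : Type*} [NormedAddCommGroup Y] [NormedSpace ℝ Y]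
    (A : Y → Y →L[ℝ] ℝ) : Prop :=
  BoundedOperator A ∧
  ∀ (u : ℕ → Y) (w : Y), WeakTendsto u w →
    Filter.limsup (fun n => A (u n) (u n - w)) atTop ≤ 0 →
    ∀ v : Y, A w (w - v) ≤ Filter.liminf (fun n => A (u n) (u n - v)) atTop

/-- `P : Y → Y*` is a penalty operator for the set `K`: `P` is bounded, demicontinuous,
monotone, and `Ker(P) = K`. -/
def IsPenaltyOperator {Y : Type*} [NormedAddCommGroup Y] [NormedSpace ℝ Y]
    (P : Y → Y →L[ℝ] ℝ) (K : Set Y) : Prop :=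
  BoundedOperator P ∧
  (∀ (u : ℕ → Y) (w : Y), Tendsto u atTop (𝓝 w) →
    ∀ v : Y, Tendsto (fun n => P (u n) v) atTop (𝓝 (P w v))) ∧
  (∀ v₁ v₂ : Y, 0 ≤ (P v₁ - P v₂) (v₁ - v₂)) ∧
  {v : Y | P v = 0} = K

/-- A real normed space is reflexive if the canonical embedding into the double dual
is surjective. -/
def IsReflexive (Y : Type*) [NormedAddCommGroup Y] [NormedSpace ℝ Y] : Prop :=
  Function.Surjective (NormedSpace.inclusionInDoubleDual ℝ Y)

lemma clarkeDeriv_zero {Y : Type*} [NormedAddCommGroup Y] [NormedSpace ℝ Y]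
    (ψ : Y → ℝ) (x : Y) : clarkeDeriv ψ x 0 = 0 := by
  simp [clarkeDeriv]

/-- Near a point of local Lipschitz continuity, difference quotients are uniformly Lipschitz in
the direction. -/
lemma LocallyLipschitz.exists_eventually_diffQuotient_le {Y : Type*} [NormedAddCommGroup Y]
    [NormedSpace ℝ Y] {ψ : Y → ℝ} (hψ : LocallyLipschitz ψ) (x₀ : Y) :
    ∃ L : ℝ, 0 ≤ L ∧ ∀ᶠ x in 𝓝 x₀, ∀ v v' : Y,
      ∀ᶠ p : Y × ℝ in (𝓝 x) ×ˢ (𝓝[>] (0 : ℝ)),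
        (ψ (p.1 + p.2 • v) - ψ p.1) / p.2
          ≤ (ψ (p.1 + p.2 • v') - ψ p.1) / p.2 + L * ‖v - v'‖ := by
  obtain ⟨L, t, ht, hL⟩ := hψ x₀
  refine ⟨L, L.2, ?_⟩
  filter_upwards [eventually_mem_nhds_iff.2 ht] with x hx v v'
  have hmem : ∀ d : Y, ∀ᶠ p : Y × ℝ in (𝓝 x) ×ˢ (𝓝[>] (0 : ℝ)), p.1 + p.2 • d ∈ t := by
    intro d
    have h : Tendsto (fun p : Y × ℝ => p.1 + p.2 • d) ((𝓝 x) ×ˢ (𝓝[>] (0 : ℝ))) (𝓝 x) := by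
      have h' : Tendsto (fun p : Y × ℝ => p.1 + p.2 • d) (𝓝 (x, 0)) (𝓝 (x + (0 : ℝ) • d)) :=
        Continuous.tendsto (by fun_prop : Continuous fun p : Y × ℝ => p.1 + p.2 • d) (x, 0)
      rw [zero_smul, add_zero, nhds_prod_eq] at h'
      exact h'.mono_left (Filter.prod_mono le_rfl nhdsWithin_le_nhds)
    exact h hx
  have hpos : ∀ᶠ p : Y × ℝ in (𝓝 x) ×ˢ (𝓝[>] (0 : ℝ)), 0 < p.2 :=
    tendsto_snd.eventually self_mem_nhdsWithin
  filter_upwards [hmem v, hmem v', hpos] with p hp hp' hp0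
  have h := hL.dist_le_mul _ hp _ hp'
  rw [Real.dist_eq, dist_eq_norm, add_sub_add_left_eq_sub, ← smul_sub, norm_smul,
    Real.norm_of_nonneg hp0.le] at h
  have h2 := (abs_le.1 h).2
  rw [div_add' _ _ _ hp0.ne']
  gcongr
  linarith

/-- Near a point of local Lipschitz continuity, difference quotients in a fixed direction are
bounded. -/
lemma LocallyLipschitz.eventually_isBounded_diffQuotient {Y : Type*} [NormedAddCommGroup Y]
    [NormedSpace ℝ Y] {ψ : Y → ℝ} (hψ : LocallyLipschitz ψ) (x v : Y) :
    (((𝓝 x) ×ˢ (𝓝[>] (0 : ℝ))).IsBoundedUnder (· ≤ ·)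
      fun p : Y × ℝ => (ψ (p.1 + p.2 • v) - ψ p.1) / p.2) ∧
    (((𝓝 x) ×ˢ (𝓝[>] (0 : ℝ))).IsCoboundedUnder (· ≤ ·)
      fun p : Y × ℝ => (ψ (p.1 + p.2 • v) - ψ p.1) / p.2) := by
  obtain ⟨L, -, hL⟩ := hψ.exists_eventually_diffQuotient_le x
  have hx := hL.self_of_nhds
  constructor
  · refine ⟨L * ‖v‖, Filter.eventually_map.2 ?_⟩
    filter_upwards [hx v 0] with p hp
    simpa using hp
  · refine Filter.IsBoundedUnder.isCoboundedUnder_le ⟨-(L * ‖v‖), Filter.eventually_map.2 ?_⟩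
    filter_upwards [hx 0 v] with p hp
    simp only [smul_zero, add_zero, sub_self, zero_div, zero_sub, norm_neg] at hp
    show -(L * ‖v‖) ≤ _
    linarith

lemma LocallyLipschitz.exists_eventually_clarkeDeriv_le {Y : Type*} [NormedAddCommGroup Y]
    [NormedSpace ℝ Y] {ψ : Y → ℝ} (hψ : LocallyLipschitz ψ) (x₀ : Y) :
    ∃ L : ℝ, 0 ≤ L ∧ ∀ᶠ x in 𝓝 x₀, ∀ v v' : Y,
      clarkeDeriv ψ x v ≤ clarkeDeriv ψ x v' + L * ‖v - v'‖ := by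
  obtain ⟨L, hL0, hL⟩ := hψ.exists_eventually_diffQuotient_le x₀
  refine ⟨L, hL0, ?_⟩
  filter_upwards [hL] with x hx v v'
  refine le_of_forall_pos_le_add fun δ hδ => ?_
  refine limsup_le_of_le (hψ.eventually_isBounded_diffQuotient x v).2 ?_
  have h := eventually_lt_of_limsup_lt (lt_add_of_pos_right (clarkeDeriv ψ x v') hδ)
    (hψ.eventually_isBounded_diffQuotient x v').1
  filter_upwards [h, hx v v'] with p hp hp'
  linarith

/-- The generalized directional derivative is jointly upper semicontinuous. -/
lemma LocallyLipschitz.upperSemicontinuous_clarkeDeriv {Y : Type*} [NormedAddCommGroup Y]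
    [NormedSpace ℝ Y] {ψ : Y → ℝ} (hψ : LocallyLipschitz ψ) :
    UpperSemicontinuous fun p : Y × Y => clarkeDeriv ψ p.1 p.2 := by
  rintro ⟨x₀, v₀⟩ c hc
  obtain ⟨c', hc₁, hc₂⟩ := exists_between hc
  obtain ⟨L, -, hL⟩ := hψ.exists_eventually_clarkeDeriv_le x₀
  have h₁ : ∀ᶠ x in 𝓝 x₀, clarkeDeriv ψ x v₀ ≤ c' := by
    have h := eventually_lt_of_limsup_lt hc₁ (hψ.eventually_isBounded_diffQuotient x₀ v₀).1
    obtain ⟨s, hs, t, ht, hst⟩ := Filter.eventually_prod_iff.1 h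
    filter_upwards [eventually_eventually_nhds.2 hs] with x hx
    refine limsup_le_of_le (hψ.eventually_isBounded_diffQuotient x v₀).2 ?_
    filter_upwards [hx.prod_mk ht] with p hp
    exact (hst hp.1 hp.2).le
  have h₂ : ∀ᶠ v in 𝓝 v₀, L * ‖v - v₀‖ < c - c' := by
    have h : Tendsto (fun v => L * ‖v - v₀‖) (𝓝 v₀) (𝓝 (L * ‖v₀ - v₀‖)) :=
      Continuous.tendsto (by fun_prop) v₀
    exact h.eventually_lt_const (by simpa using hc₂)
  rw [nhds_prod_eq]
  filter_upwards [(h₁.and hL).prod_mk h₂] with p hp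
  linarith [hp.1.1, hp.1.2 p.2 v₀, hp.2]

/-- A finite convex lower semicontinuous function on a Banach space is continuous. -/
lemma ConvexOn.continuous_of_lowerSemicontinuous {Y : Type*} [NormedAddCommGroup Y]
    [NormedSpace ℝ Y] [CompleteSpace Y] {ψ : Y → ℝ} (hψ : ConvexOn ℝ Set.univ ψ)
    (hlsc : LowerSemicontinuous ψ) : Continuous ψ := by
  obtain ⟨n, x, hx⟩ := nonempty_interior_of_iUnion_of_closed
    (fun n : ℕ => hlsc.isClosed_preimage (n : ℝ))
    (Set.eq_univ_of_forall fun x => Set.mem_iUnion.2 (exists_nat_ge (ψ x)))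
  rw [← continuousOn_univ]
  have hiff : ContinuousOn ψ Set.univ ↔
      ∃ x₀ ∈ Set.univ, (𝓝 x₀).IsBoundedUnder (· ≤ ·) ψ :=
    (hψ.continuousOn_tfae isOpen_univ Set.univ_nonempty).out 1 3
  refine hiff.2 ⟨x, Set.mem_univ x, n, Filter.eventually_map.2 ?_⟩
  exact mem_interior_iff_mem_nhds.1 hx

lemma ConvexOn.exists_affine_le_of_lowerSemicontinuous {Y : Type*} [NormedAddCommGroup Y]
    [NormedSpace ℝ Y] {ψ : Y → ℝ} (hψ : ConvexOn ℝ Set.univ ψ)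
    (hlsc : LowerSemicontinuous ψ) : ∃ (g : Y →L[ℝ] ℝ) (c : ℝ), ∀ x, g x + c ≤ ψ x := by
  obtain ⟨g, c, hg, -⟩ := hψ.exists_affine_le_of_lt (𝕜 := ℝ) (Set.mem_univ (0 : Y))
    (sub_one_lt (ψ 0)) isClosed_univ (hlsc.lowerSemicontinuousOn _)
  exact ⟨g, c, fun x => by simpa using hg ⟨x, Set.mem_univ x⟩⟩

/-- Bounded sequences in a reflexive space converge weakly along ultrafilters. -/
lemma IsReflexive.exists_weak_limit {Y ι : Type*} [NormedAddCommGroup Y] [NormedSpace ℝ Y]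
    (hY : IsReflexive Y) (l : Ultrafilter ι) {x : ι → Y} {R : ℝ}
    (hx : ∀ᶠ i in (l : Filter ι), ‖x i‖ ≤ R) :
    ∃ w : Y, ∀ g : Y →L[ℝ] ℝ, Tendsto (fun i => g (x i)) l (𝓝 (g w)) := by
  let J : Y → WeakDual ℝ (StrongDual ℝ Y) := fun y =>
    StrongDual.toWeakDual (NormedSpace.inclusionInDoubleDual ℝ Y y)
  have hmem : ∀ᶠ i in (l : Filter ι), J (x i) ∈
      WeakDual.toStrongDual ⁻¹' Metric.closedBall (0 : StrongDual ℝ (StrongDual ℝ Y)) R := by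
    filter_upwards [hx] with i hi
    have h : ‖NormedSpace.inclusionInDoubleDual ℝ Y (x i)‖ ≤ R :=
      (NormedSpace.double_dual_bound ℝ Y (x i)).trans hi
    exact (mem_closedBall_zero_iff (E := StrongDual ℝ (StrongDual ℝ Y))).2 h
  obtain ⟨ξ, -, hξ⟩ := (WeakDual.isCompact_closedBall (𝕜 := ℝ)
    (0 : StrongDual ℝ (StrongDual ℝ Y)) R).ultrafilter_le_nhds (l.map fun i => J (x i))
    (le_principal_iff.2 hmem)
  obtain ⟨w, hw⟩ := hY (WeakDual.toStrongDual ξ)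
  refine ⟨w, fun g => ?_⟩
  have h : Tendsto (fun i => J (x i) g) l (𝓝 (ξ g)) :=
    ((WeakDual.eval_continuous g).tendsto ξ).comp hξ
  have hwg : ξ g = g w := by
    rw [← NormedSpace.dual_def ℝ Y w g, hw]
    rfl
  rw [hwg] at h
  exact h

/-- A compact operator maps weak convergence along an ultrafilter to strong convergence. -/
lemma IsCompactOperator.tendsto_of_weak {Y Z ι : Type*} [NormedAddCommGroup Y] [NormedSpace ℝ Y]
    [NormedAddCommGroup Z] [NormedSpace ℝ Z] {T : Y →L[ℝ] Z} (hT : IsCompactOperator T)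
    (l : Ultrafilter ι) {x : ι → Y} {w : Y} {R : ℝ}
    (hx : ∀ᶠ i in (l : Filter ι), ‖x i‖ ≤ R)
    (hw : ∀ g : Y →L[ℝ] ℝ, Tendsto (fun i => g (x i)) l (𝓝 (g w))) :
    Tendsto (fun i => T (x i)) l (𝓝 (T w)) := by
  obtain ⟨C, hC, hTC⟩ := IsCompactOperator.image_closedBall_subset_compact
    (f := (T : Y →ₗ[ℝ] Z)) hT R
  have hmem : ∀ᶠ i in (l : Filter ι), T (x i) ∈ C := by
    filter_upwards [hx] with i hi
    exact hTC ⟨x i, mem_closedBall_zero_iff.2 hi, rfl⟩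
  obtain ⟨z, -, hz⟩ := hC.ultrafilter_le_nhds (l.map fun i => T (x i)) (le_principal_iff.2 hmem)
  have hz' : Tendsto (fun i => T (x i)) l (𝓝 z) := hz
  have hzw : z = T w := by
    refine (SeparatingDual.eq_iff_forall_dual_eq (R := ℝ)).2 fun g => ?_
    exact tendsto_nhds_unique ((g.continuous.tendsto z).comp hz') (hw (g.comp T))
  rwa [hzw] at hz'

lemma BoundedOperator.exists_norm_le {Y : Type*} [NormedAddCommGroup Y] [NormedSpace ℝ Y]
    {A : Y → Y →L[ℝ] ℝ} (hA : BoundedOperator A) (R : ℝ) :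
    ∃ C : ℝ, 0 ≤ C ∧ ∀ x, ‖x‖ ≤ R → ‖A x‖ ≤ C := by
  obtain ⟨C, hC⟩ := (hA _ (Metric.isBounded_closedBall (x := (0 : Y)) (r := R))).exists_norm_le
  exact ⟨max C 0, le_max_right _ _, fun x hx => (hC _
    ⟨x, mem_closedBall_zero_iff.2 hx, rfl⟩).trans (le_max_left _ _)⟩

/-- Upper semicontinuity of `(y, x) ↦ φ y x - φ y y` along convergent families. -/
lemma eventually_bifunction_sub_le {Y ι : Type*} [NormedAddCommGroup Y] {φ : Y → Y → ℝ} {α : ℝ}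
    (hcont : ∀ z, Continuous (φ z))
    (hφ : ∀ z₁ z₂ z₃ z₄ : Y,
      φ z₁ z₄ - φ z₁ z₃ + φ z₂ z₃ - φ z₂ z₄ ≤ α * ‖z₁ - z₂‖ * ‖z₃ - z₄‖)
    {l : Filter ι} {y x : ι → Y} {y₀ x₀ : Y} (hy : Tendsto y l (𝓝 y₀)) (hx : Tendsto x l (𝓝 x₀))
    {δ : ℝ} (hδ : 0 < δ) :
    ∀ᶠ i in l, φ (y i) (x i) - φ (y i) (y i) ≤ φ y₀ x₀ - φ y₀ y₀ + δ := by
  have h : Tendsto (fun i => α * ‖y i - y₀‖ * ‖y i - x i‖ + φ y₀ (x i) - φ y₀ (y i)) l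
      (𝓝 (α * ‖y₀ - y₀‖ * ‖y₀ - x₀‖ + φ y₀ x₀ - φ y₀ y₀)) :=
    (((((hy.sub tendsto_const_nhds).norm).const_mul α).mul (hy.sub hx).norm).add
      (((hcont y₀).tendsto x₀).comp hx)).sub (((hcont y₀).tendsto y₀).comp hy)
  filter_upwards [h.eventually_lt_const (lt_add_of_pos_right _ hδ)] with i hi
  rw [sub_self, norm_zero] at hi
  linarith [hφ (y i) y₀ (y i) (x i)]

lemma LocallyLipschitz.eventually_clarkeDeriv_sub_le {Y ι : Type*} [NormedAddCommGroup Y]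
    [NormedSpace ℝ Y] {ψ : Y → ℝ} (hψ : LocallyLipschitz ψ)
    {l : Filter ι} {y x : ι → Y} {y₀ x₀ : Y} (hy : Tendsto y l (𝓝 y₀)) (hx : Tendsto x l (𝓝 x₀))
    {δ : ℝ} (hδ : 0 < δ) :
    ∀ᶠ i in l, clarkeDeriv ψ (y i) (x i - y i) ≤ clarkeDeriv ψ y₀ (x₀ - y₀) + δ := by
  have h := (hy.prodMk_nhds (hx.sub hy)).eventually
    (hψ.upperSemicontinuous_clarkeDeriv (y₀, x₀ - y₀) _ (lt_add_of_pos_right _ hδ))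
  exact h.mono fun i hi => hi.le

/-- Minty's argument for the equation `P w = 0`. -/
lemma eq_zero_of_forall_apply_sub_nonpos {Y : Type*} [NormedAddCommGroup Y] [NormedSpace ℝ Y]
    {P : Y → Y →L[ℝ] ℝ}
    (hP : ∀ (u : ℕ → Y) (w : Y), Tendsto u atTop (𝓝 w) →
      ∀ v : Y, Tendsto (fun n => P (u n) v) atTop (𝓝 (P w v)))
    {w : Y} (hw : ∀ v, P v (w - v) ≤ 0) : P w = 0 := by
  have key : ∀ h, 0 ≤ P w h := by
    intro h
    have hlim : Tendsto (fun n : ℕ => w + (1 / ((n : ℝ) + 1)) • h) atTop (𝓝 w) := by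
      simpa using (tendsto_one_div_add_atTop_nhds_zero_nat (𝕜 := ℝ)).smul_const h |>.const_add w
    refine ge_of_tendsto' (hP _ _ hlim h) fun n => ?_
    have hn : (0 : ℝ) < 1 / ((n : ℝ) + 1) := by positivity
    have h1 := hw (w + (1 / ((n : ℝ) + 1)) • h)
    rw [sub_add_cancel_left, map_neg, map_smul, smul_eq_mul, neg_nonpos] at h1
    exact nonneg_of_mul_nonneg_right h1 hn
  ext h
  have h1 := key (-h)
  rw [map_neg] at h1
  simpa using le_antisymm (by linarith) (key h)

/-- Solutions of the discrete inequalities tested with a strongly convergent sequence stay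
bounded. -/
lemma exists_eventually_norm_le_of_discrete_ineq {X Xφ Xj ι : Type*}
    [NormedAddCommGroup X] [NormedSpace ℝ X]
    [NormedAddCommGroup Xφ] [NormedSpace ℝ Xφ] [CompleteSpace Xφ]
    [NormedAddCommGroup Xj] [NormedSpace ℝ Xj]
    {γφ : X →L[ℝ] Xφ} {cφ : ℝ} (hcφ : 0 < cφ) (hγφ : ∀ v : X, ‖γφ v‖ ≤ cφ * ‖v‖)
    {γj : X →L[ℝ] Xj} {cj : ℝ} (hγj : ∀ v : X, ‖γj v‖ ≤ cj * ‖v‖)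
    {A : X → X →L[ℝ] ℝ} (hA : BoundedOperator A) {mA : ℝ}
    (hAsm : ∀ v₁ v₂ : X, mA * ‖v₁ - v₂‖ ^ 2 ≤ (A v₁ - A v₂) (v₁ - v₂))
    {φ : Xφ → Xφ → ℝ} (hφcv : ∀ z : Xφ, ConvexOn ℝ Set.univ (φ z))
    (hφlsc : ∀ z : Xφ, LowerSemicontinuous (φ z)) {αφ : ℝ} (hαφ : 0 ≤ αφ)
    (hφ : ∀ z₁ z₂ z₃ z₄ : Xφ,
      φ z₁ z₄ - φ z₁ z₃ + φ z₂ z₃ - φ z₂ z₄ ≤ αφ * ‖z₁ - z₂‖ * ‖z₃ - z₄‖)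
    {j : Xj → ℝ} (hj : LocallyLipschitz j) {αj : ℝ} (hαj : 0 ≤ αj)
    (hj2 : ∀ z₁ z₂ : Xj,
      clarkeDeriv j z₁ (z₂ - z₁) + clarkeDeriv j z₂ (z₁ - z₂) ≤ αj * ‖z₁ - z₂‖ ^ 2)
    (hsmall : αφ * cφ ^ 2 + αj * cj ^ 2 < mA) (f : X →L[ℝ] ℝ)
    {l : Filter ι} {x v : ι → X} {u : X} (hv : Tendsto v l (𝓝 u))
    (hx : ∀ i, f (v i - x i) ≤ A (x i) (v i - x i)
        + (φ (γφ (x i)) (γφ (v i)) - φ (γφ (x i)) (γφ (x i)))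
        + clarkeDeriv j (γj (x i)) (γj (v i) - γj (x i))) :
    ∃ R : ℝ, ∀ᶠ i in l, ‖x i‖ ≤ R := by
  obtain ⟨C, hC0, hC⟩ := hA.exists_norm_le (‖u‖ + 1)
  obtain ⟨g, c, hg⟩ := (hφcv (γφ u)).exists_affine_le_of_lowerSemicontinuous (hφlsc (γφ u))
  obtain ⟨L, hL0, hL⟩ := hj.exists_eventually_clarkeDeriv_le (γj u)
  set G := ‖g.comp γφ‖
  set M := φ (γφ u) (γφ u)
  set C₁ := ‖f‖ + C + αφ * cφ ^ 2 + G + L * cj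
  set C₂ := M + 1 + G * (‖u‖ + 1) - c
  set κ := mA - (αφ * cφ ^ 2 + αj * cj ^ 2)
  have hκ : 0 < κ := sub_pos.2 hsmall
  have hclose : ∀ᶠ i in l, ‖v i - u‖ < 1 :=
    (hv.sub_const u).norm.eventually_lt_const (by simp)
  have hφv : ∀ᶠ i in l, φ (γφ u) (γφ (v i)) < M + 1 :=
    ((((hφcv (γφ u)).continuous_of_lowerSemicontinuous (hφlsc (γφ u))).comp
      γφ.continuous).tendsto u |>.comp hv).eventually_lt_const (lt_add_one M)
  have hLv := ((γj.continuous.tendsto u).comp hv).eventually hL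
  refine ⟨(|C₁| + |C₂|) / κ + 1 + (‖u‖ + 1), ?_⟩
  filter_upwards [hclose, hφv, hLv] with i hi hφi hLi
  set d := ‖x i - v i‖ with hd
  have hd0 : 0 ≤ d := norm_nonneg _
  have hvi : ‖v i‖ ≤ ‖u‖ + 1 := by
    linarith [norm_le_norm_add_norm_sub' (v i) u]
  have hxi : ‖x i‖ ≤ d + (‖u‖ + 1) := by
    linarith [norm_le_norm_add_norm_sub' (x i) (v i)]
  have hfd : f (x i - v i) ≤ ‖f‖ * d := (le_abs_self _).trans (f.le_opNorm _)
  have hAd : -(A (v i) (x i - v i)) ≤ C * d := by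
    refine (neg_le_abs _).trans (((A (v i)).le_opNorm _).trans ?_)
    gcongr
    exact hC _ hvi
  have hφd : φ (γφ (x i)) (γφ (v i)) - φ (γφ (x i)) (γφ (x i)) ≤
      αφ * (cφ * (d + 1)) * (cφ * d) + (M + 1) + (G * (d + (‖u‖ + 1)) - c) := by
    have h1 := hφ (γφ (x i)) (γφ u) (γφ (x i)) (γφ (v i))
    have h2 : αφ * ‖γφ (x i) - γφ u‖ * ‖γφ (x i) - γφ (v i)‖
        ≤ αφ * (cφ * (d + 1)) * (cφ * d) := by
      rw [← map_sub, ← map_sub]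
      gcongr
      · refine (hγφ _).trans ?_
        gcongr
        linarith [norm_sub_le_norm_sub_add_norm_sub (x i) (v i) u]
      · exact hγφ _
    have h3 : -(g (γφ (x i))) ≤ G * (d + (‖u‖ + 1)) := by
      refine (neg_le_abs _).trans (((g.comp γφ).le_opNorm (x i)).trans ?_)
      gcongr
    linarith [hg (γφ (x i))]
  have hjd : clarkeDeriv j (γj (x i)) (γj (v i) - γj (x i)) ≤
      αj * (cj * d) ^ 2 + L * (cj * d) := by
    have hn : ‖γj (x i) - γj (v i)‖ ≤ cj * d := by
      rw [← map_sub]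
      exact hγj _
    have h1 := hj2 (γj (x i)) (γj (v i))
    have h2 := hLi 0 (γj (x i) - γj (v i))
    rw [clarkeDeriv_zero, zero_sub, norm_neg] at h2
    have h3 : αj * ‖γj (x i) - γj (v i)‖ ^ 2 ≤ αj * (cj * d) ^ 2 := by gcongr
    have h4 : L * ‖γj (x i) - γj (v i)‖ ≤ L * (cj * d) := by gcongr
    simp only [Function.comp_apply] at h2
    linarith
  have hmain : κ * d ^ 2 ≤ C₁ * d + C₂ := by
    have h1 := hAsm (x i) (v i)
    have h2 := hx i
    rw [← neg_sub (x i) (v i), map_neg, map_neg] at h2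
    rw [sub_apply] at h1
    simp only [κ, C₁, C₂]
    linarith
  have hd' : d ≤ (|C₁| + |C₂|) / κ + 1 := by
    by_contra! hlt
    have h0 : 0 ≤ (|C₁| + |C₂|) / κ := by positivity
    have h1 : (|C₁| + |C₂|) < κ * d := by
      rw [mul_comm, ← div_lt_iff₀ hκ]
      linarith
    have h2 : (|C₁| + |C₂|) * d < κ * d * d := by
      gcongr
      linarith
    have h3 : C₁ * d ≤ |C₁| * d := by
      gcongr
      exact le_abs_self _
    have h4 : C₂ ≤ |C₂| * d := by
      nlinarith [le_abs_self C₂, abs_nonneg C₂]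
    linarith
  linarith

/-- Theorem: convergence of the penalty based numerical method: under
(A1)–(A10), the solutions `uₙ` of the discrete penalized problems converge strongly in
`X` to the solution `u` of the constrained variational-hemivariational inequality. -/
theorem penalized_numerical_convergence
    {X Xφ Xj : Type*}
    [NormedAddCommGroup X] [NormedSpace ℝ X] [CompleteSpace X]
    [NormedAddCommGroup Xφ] [NormedSpace ℝ Xφ] [CompleteSpace Xφ]
    [NormedAddCommGroup Xj] [NormedSpace ℝ Xj] [CompleteSpace Xj]
    -- (A1)
    (hrefl : IsReflexive X)
    (K : Set X) (hKne : K.Nonempty) (hKcl : IsClosed K) (hKcv : Convex ℝ K)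
    -- (A2)
    (γφ : X →L[ℝ] Xφ) (cφ : ℝ) (hcφ : 0 < cφ) (hγφ : ∀ v : X, ‖γφ v‖ ≤ cφ * ‖v‖)
    -- (A3)
    (γj : X →L[ℝ] Xj) (cj : ℝ) (hcj : 0 < cj) (hγj : ∀ v : X, ‖γj v‖ ≤ cj * ‖v‖)
    -- (A4)
    (A : X → X →L[ℝ] ℝ) (hA : Pseudomonotone A)
    (mA : ℝ) (hmA : 0 < mA)
    (hAsm : ∀ v₁ v₂ : X, mA * ‖v₁ - v₂‖ ^ 2 ≤ (A v₁ - A v₂) (v₁ - v₂))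
    -- (A5)
    (φ : Xφ → Xφ → ℝ)
    (hφcv : ∀ z : Xφ, ConvexOn ℝ Set.univ (φ z))
    (hφlsc : ∀ z : Xφ, LowerSemicontinuous (φ z))
    (αφ : ℝ) (hαφ : 0 ≤ αφ)
    (hφ : ∀ z₁ z₂ z₃ z₄ : Xφ,
      φ z₁ z₄ - φ z₁ z₃ + φ z₂ z₃ - φ z₂ z₄ ≤ αφ * ‖z₁ - z₂‖ * ‖z₃ - z₄‖)
    -- (A6)
    (j : Xj → ℝ) (hj : LocallyLipschitz j)
    (c₀ c₁ : ℝ) (hc₀ : 0 ≤ c₀) (hc₁ : 0 ≤ c₁)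
    (hjsub : ∀ (z : Xj), ∀ ζ ∈ clarkeSubdiff j z, ‖ζ‖ ≤ c₀ + c₁ * ‖z‖)
    (αj : ℝ) (hαj : 0 ≤ αj)
    (hj2 : ∀ z₁ z₂ : Xj,
      clarkeDeriv j z₁ (z₂ - z₁) + clarkeDeriv j z₂ (z₁ - z₂) ≤ αj * ‖z₁ - z₂‖ ^ 2)
    -- (A7)
    (hsmall : αφ * cφ ^ 2 + αj * cj ^ 2 < mA)
    -- (A8)
    (f : X →L[ℝ] ℝ)
    -- (A10): compactness of γφ and γj
    (hγφcpt : IsCompactOperator γφ) (hγjcpt : IsCompactOperator γj)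
    -- penalty operator
    (P : X → X →L[ℝ] ℝ) (hP : IsPenaltyOperator P K)
    -- the solution of the constrained problem (P)
    (u : X) (huK : u ∈ K)
    (hu : ∀ v ∈ K,
      f (v - u) ≤ A u (v - u) + (φ (γφ u) (γφ v) - φ (γφ u) (γφ u))
        + clarkeDeriv j (γj u) (γj v - γj u))
    -- penalty parameters
    (ε : ℕ → ℝ) (hε : ∀ n, 0 < ε n) (hε0 : Tendsto ε atTop (𝓝 0))
    -- (A9): approximability by the finite-dimensional subspaces
    (V : ℕ → Submodule ℝ X) (hV : ∀ n, FiniteDimensional ℝ (V n))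
    (hA9X : ∀ v : X, ∃ vh : ℕ → X, (∀ n, vh n ∈ V n) ∧ Tendsto vh atTop (𝓝 v))
    (hA9K : ∀ v ∈ K, ∃ vh : ℕ → X, (∀ n, vh n ∈ V n ∧ vh n ∈ K) ∧ Tendsto vh atTop (𝓝 v))
    -- the discrete penalized solutions
    (un : ℕ → X) (hunV : ∀ n, un n ∈ V n)
    (hun : ∀ n, ∀ vh ∈ V n,
      f (vh - un n) ≤ A (un n) (vh - un n) + (1 / ε n) * P (un n) (vh - un n)
        + (φ (γφ (un n)) (γφ vh) - φ (γφ (un n)) (γφ (un n)))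
        + clarkeDeriv j (γj (un n)) (γj vh - γj (un n))) :
    Tendsto un atTop (𝓝 u) := by
  obtain ⟨hPbdd, hPdemi, hPmono, hPker⟩ := hP
  have hφcont : ∀ z, Continuous (φ z) := fun z =>
    (hφcv z).continuous_of_lowerSemicontinuous (hφlsc z)
  obtain ⟨v, hvVK, hv⟩ := hA9K u huK
  have htest : ∀ n, f (v n - un n) ≤ A (un n) (v n - un n)
      + (φ (γφ (un n)) (γφ (v n)) - φ (γφ (un n)) (γφ (un n)))
      + clarkeDeriv j (γj (un n)) (γj (v n) - γj (un n)) := by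
    intro n
    have hPv : P (v n) = 0 := hPker.ge (hvVK n).2
    have h1 := hPmono (un n) (v n)
    rw [hPv, sub_zero, ← neg_sub (v n) (un n), map_neg, neg_nonneg] at h1
    have h2 : (1 / ε n) * P (un n) (v n - un n) ≤ 0 :=
      mul_nonpos_of_nonneg_of_nonpos (one_div_pos.2 (hε n)).le h1
    linarith [hun n (v n) (hvVK n).1]
  obtain ⟨R, hR⟩ := exists_eventually_norm_le_of_discrete_ineq hcφ hγφ hγj hA.1 hAsm hφcv hφlsc
    hαφ hφ hj hαj hj2 hsmall f hv htest
  obtain ⟨CA, hCA0, hCA⟩ := hA.1.exists_norm_le R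
  obtain ⟨CP, hCP0, hCP⟩ := hPbdd.exists_norm_le R
  rw [tendsto_iff_ultrafilter]
  intro l hl
  have hRl : ∀ᶠ n in (l : Filter ℕ), ‖un n‖ ≤ R := hl hR
  obtain ⟨w, hw⟩ := hrefl.exists_weak_limit l hRl
  have hwφ := hγφcpt.tendsto_of_weak l hRl hw
  have hwj := hγjcpt.tendsto_of_weak l hRl hw
  have hwK : w ∈ K := by
    have hPw : P w = 0 := by
      refine eq_zero_of_forall_apply_sub_nonpos hPdemi fun z => ?_
      obtain ⟨y, hyV, hy⟩ := hA9X z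
      have hyl := hy.mono_left hl
      set C := (CA + ‖f‖) * (‖z‖ + 1 + R) + (φ (γφ w) (γφ z) - φ (γφ w) (γφ w) + 1)
        + (clarkeDeriv j (γj w) (γj z - γj w) + 1)
      have hbound : ∀ᶠ n in (l : Filter ℕ), P (un n) (un n - y n) ≤ C * ε n := by
        have hyn : ∀ᶠ n in (l : Filter ℕ), ‖y n‖ < ‖z‖ + 1 :=
          hyl.norm.eventually_lt_const (lt_add_one _)
        filter_upwards [hyn, hRl, eventually_bifunction_sub_le hφcont hφ hwφ
          ((γφ.continuous.tendsto z).comp hyl) one_pos, hj.eventually_clarkeDeriv_sub_le hwj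
          ((γj.continuous.tendsto z).comp hyl) one_pos] with n h1 h2 h3 h4
        simp only [Function.comp_apply] at h3 h4
        have h5 := hun n (y n) (hyV n)
        have h6 : ‖y n - un n‖ ≤ ‖z‖ + 1 + R := (norm_sub_le _ _).trans (by linarith)
        have h7 : A (un n) (y n - un n) ≤ CA * (‖z‖ + 1 + R) :=
          ((le_abs_self _).trans ((A (un n)).le_opNorm _)).trans
            (mul_le_mul (hCA _ h2) h6 (norm_nonneg _) hCA0)
        have h8 : -(f (y n - un n)) ≤ ‖f‖ * (‖z‖ + 1 + R) :=
          ((neg_le_abs _).trans (f.le_opNorm _)).trans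
            (mul_le_mul_of_nonneg_left h6 (norm_nonneg _))
        rw [← div_le_iff₀ (hε n), ← neg_sub (y n) (un n), map_neg, div_eq_mul_one_div, mul_comm]
        simp only [C]
        linarith
      have hlim₁ : Tendsto (fun n => P z (un n - z)) l (𝓝 (P z (w - z))) := by
        simpa only [map_sub] using (hw (P z)).sub_const (P z z)
      have hlim₂ : Tendsto (fun n => C * ε n + CP * ‖y n - z‖) l (𝓝 0) := by
        simpa using ((hε0.mono_left hl).const_mul C).add
          (((hyl.sub_const z).norm).const_mul CP)
      refine le_of_tendsto_of_tendsto hlim₁ hlim₂ ?_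
      filter_upwards [hbound, hRl] with n h1 h2
      have h3 := hPmono (un n) z
      have h4 : P (un n) (y n - z) ≤ CP * ‖y n - z‖ :=
        ((le_abs_self _).trans ((P (un n)).le_opNorm _)).trans
          (mul_le_mul_of_nonneg_right (hCP _ h2) (norm_nonneg _))
      simp only [sub_apply, map_sub] at h1 h3 h4 ⊢
      linarith
    exact hPker.le hPw
  set α := αφ * cφ ^ 2 + αj * cj ^ 2
  have hkey : ∀ δ > 0, ∀ᶠ n in (l : Filter ℕ), mA * ‖un n - u‖ ^ 2 ≤ α * ‖u - w‖ ^ 2 + δ := by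
    intro δ hδ
    have hvl := hv.mono_left hl
    have hδ' : 0 < δ / 5 := by positivity
    have hlim₁ : Tendsto (fun n => f (un n - v n)) l (𝓝 (f (w - u))) := by
      simpa only [map_sub, Function.comp_apply] using
        (hw f).sub ((f.continuous.tendsto u).comp hvl)
    have hlim₂ : Tendsto (fun n => A u (un n - u)) l (𝓝 (A u (w - u))) := by
      simpa only [map_sub] using (hw (A u)).sub_const (A u u)
    have hlim₃ : Tendsto (fun n => CA * ‖v n - u‖) l (𝓝 0) := by
      simpa using ((hvl.sub_const u).norm).const_mul CA
    filter_upwards [hRl, hlim₁.eventually_lt_const (lt_add_of_pos_right _ hδ'),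
      hlim₂.eventually_const_lt (sub_lt_self _ hδ'), hlim₃.eventually_lt_const hδ',
      eventually_bifunction_sub_le hφcont hφ hwφ ((γφ.continuous.tendsto u).comp hvl) hδ',
      hj.eventually_clarkeDeriv_sub_le hwj ((γj.continuous.tendsto u).comp hvl) hδ']
      with n h0 h1 h2 h3 h4 h5
    simp only [Function.comp_apply] at h4 h5
    have h6 : A (un n) (v n - u) ≤ CA * ‖v n - u‖ :=
      ((le_abs_self _).trans ((A (un n)).le_opNorm _)).trans
        (mul_le_mul_of_nonneg_right (hCA _ h0) (norm_nonneg _))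
    have h7 := hAsm (un n) u
    have h8 := htest n
    have h9 := hu w hwK
    have h10 := hφ (γφ w) (γφ u) (γφ w) (γφ u)
    have h11 := hj2 (γj w) (γj u)
    have h12 : αφ * ‖γφ w - γφ u‖ * ‖γφ w - γφ u‖ ≤ αφ * cφ ^ 2 * ‖u - w‖ ^ 2 := by
      have h := hγφ (w - u)
      rw [map_sub, norm_sub_rev w u] at h
      calc _ = αφ * ‖γφ w - γφ u‖ ^ 2 := by ring
        _ ≤ αφ * (cφ * ‖u - w‖) ^ 2 := by gcongr
        _ = _ := by ring
    have h13 : αj * ‖γj w - γj u‖ ^ 2 ≤ αj * cj ^ 2 * ‖u - w‖ ^ 2 := by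
      have h := hγj (w - u)
      rw [map_sub, norm_sub_rev w u] at h
      calc _ ≤ αj * (cj * ‖u - w‖) ^ 2 := by gcongr
        _ = _ := by ring
    simp only [sub_apply, map_sub, α] at *
    linarith
  have hwu : w = u := by
    obtain ⟨g, hg1, hgw⟩ := exists_dual_vector'' ℝ (w - u)
    have hlim : Tendsto (fun n => mA * (g (un n - u)) ^ 2) l (𝓝 (mA * ‖w - u‖ ^ 2)) := by
      have h : Tendsto (fun n => g (un n - u)) l (𝓝 (g (w - u))) := by
        simpa only [map_sub] using (hw g).sub_const (g u)
      rw [hgw] at h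
      exact (h.pow 2).const_mul mA
    have hle : mA * ‖w - u‖ ^ 2 ≤ α * ‖u - w‖ ^ 2 := by
      refine le_of_forall_pos_le_add fun δ hδ => le_of_tendsto hlim ?_
      filter_upwards [hkey δ hδ] with n hn
      refine le_trans ?_ hn
      have h : |g (un n - u)| ≤ ‖un n - u‖ := by
        simpa using g.le_of_opNorm_le hg1 (un n - u)
      rw [← sq_abs]
      gcongr
    rw [norm_sub_rev u w] at hle
    by_contra hne
    have hpos : 0 < ‖w - u‖ ^ 2 := by
      have := norm_pos_iff.2 (sub_ne_zero.2 hne)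
      positivity
    nlinarith
  rw [tendsto_iff_norm_sub_tendsto_zero]
  rw [hwu] at hkey
  have hsq : Tendsto (fun n => ‖un n - u‖ ^ 2) l (𝓝 0) := by
    refine tendsto_order.2 ⟨fun a ha => .of_forall fun n => ha.trans_le (sq_nonneg _),
      fun a ha => ?_⟩
    filter_upwards [hkey (mA * a / 2) (by positivity)] with n hn
    rw [sub_self, norm_zero] at hn
    nlinarith [mul_pos hmA ha]
  simpa using hsq.sqrt
end

section
/- Assume (A1), (A3), (A4), (A6), (A7)' (α_j c_j² < m_A), and (A8). Then there exists a unique element u ∈ K such that ⟨A u, v − u⟩ + j⁰(γ_j u; γ_j v − γ_j u) ≥ ⟨f, v − u⟩ for all v ∈ K. -/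
open Filter Topology Bornology

section Clarke

variable {Y : Type*} [NormedAddCommGroup Y] [NormedSpace ℝ Y] {ψ : Y → ℝ}

/-- The difference quotients of a locally Lipschitz function are bounded near a point, linearly in
the direction. -/
theorem LocallyLipschitz.exists_eventually_abs_quotient_le (hψ : LocallyLipschitz ψ) (x : Y) :
    ∃ L : ℝ, 0 ≤ L ∧ ∀ v : Y, ∀ᶠ p : Y × ℝ in 𝓝 x ×ˢ 𝓝[>] (0 : ℝ),
      |(ψ (p.1 + p.2 • v) - ψ p.1) / p.2| ≤ L * ‖v‖ := by
  obtain ⟨L, t, ht, hL⟩ := hψ x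
  refine ⟨L, L.2, fun v => ?_⟩
  have hfst : Tendsto (fun p : Y × ℝ => p.1) (𝓝 x ×ˢ 𝓝[>] (0 : ℝ)) (𝓝 x) := tendsto_fst
  have hsnd : Tendsto (fun p : Y × ℝ => p.2) (𝓝 x ×ˢ 𝓝[>] (0 : ℝ)) (𝓝[>] 0) := tendsto_snd
  have hsum : Tendsto (fun p : Y × ℝ => p.1 + p.2 • v) (𝓝 x ×ˢ 𝓝[>] (0 : ℝ)) (𝓝 x) := by
    simpa using hfst.add ((hsnd.mono_right nhdsWithin_le_nhds).smul_const v)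
  filter_upwards [hfst ht, hsum ht, hsnd self_mem_nhdsWithin] with p h1 h2 h3
  have h3 : 0 < p.2 := h3
  have h := hL.dist_le_mul _ h2 _ h1
  rw [Real.dist_eq, dist_eq_norm, add_sub_cancel_left, norm_smul, Real.norm_of_nonneg h3.le] at h
  rw [abs_div, abs_of_pos h3, div_le_iff₀ h3]
  linarith

theorem clarkeDeriv_le_of_eventually_le (hψ : LocallyLipschitz ψ) {x v : Y} {a : ℝ}
    (h : ∀ᶠ p : Y × ℝ in 𝓝 x ×ˢ 𝓝[>] (0 : ℝ), (ψ (p.1 + p.2 • v) - ψ p.1) / p.2 ≤ a) :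
    clarkeDeriv ψ x v ≤ a := by
  obtain ⟨L, -, hL⟩ := hψ.exists_eventually_abs_quotient_le x
  refine limsup_le_of_le ?_ h
  refine IsBoundedUnder.isCoboundedUnder_le ⟨-(L * ‖v‖), ?_⟩
  exact eventually_map.2 ((hL v).mono fun p hp => (abs_le.1 hp).1)

theorem eventually_lt_of_clarkeDeriv_lt (hψ : LocallyLipschitz ψ) {x v : Y} {a : ℝ}
    (h : clarkeDeriv ψ x v < a) :
    ∀ᶠ p : Y × ℝ in 𝓝 x ×ˢ 𝓝[>] (0 : ℝ), (ψ (p.1 + p.2 • v) - ψ p.1) / p.2 < a := by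
  obtain ⟨L, -, hL⟩ := hψ.exists_eventually_abs_quotient_le x
  refine eventually_lt_of_limsup_lt h ⟨L * ‖v‖, ?_⟩
  exact eventually_map.2 ((hL v).mono fun p hp => (abs_le.1 hp).2)

theorem exists_abs_clarkeDeriv_le (hψ : LocallyLipschitz ψ) (x : Y) :
    ∃ L : ℝ, 0 ≤ L ∧ ∀ v : Y, |clarkeDeriv ψ x v| ≤ L * ‖v‖ := by
  obtain ⟨L, hL0, hL⟩ := hψ.exists_eventually_abs_quotient_le x
  refine ⟨L, hL0, fun v => abs_le.2 ⟨le_of_not_gt fun h => ?_, ?_⟩⟩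
  · obtain ⟨p, h1, h2⟩ := ((eventually_lt_of_clarkeDeriv_lt hψ h).and (hL v)).exists
    linarith [(abs_le.1 h2).1]
  · exact clarkeDeriv_le_of_eventually_le hψ ((hL v).mono fun p hp => (abs_le.1 hp).2)

theorem clarkeDeriv_add_le (hψ : LocallyLipschitz ψ) (x v w : Y) :
    clarkeDeriv ψ x (v + w) ≤ clarkeDeriv ψ x v + clarkeDeriv ψ x w := by
  refine le_of_forall_pos_le_add fun ε hε => clarkeDeriv_le_of_eventually_le hψ ?_
  have hv := eventually_lt_of_clarkeDeriv_lt hψ (lt_add_of_pos_right (clarkeDeriv ψ x v)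
    (half_pos hε))
  have hw := eventually_lt_of_clarkeDeriv_lt hψ (lt_add_of_pos_right (clarkeDeriv ψ x w)
    (half_pos hε))
  have hsnd : Tendsto (fun p : Y × ℝ => p.2) (𝓝 x ×ˢ 𝓝[>] (0 : ℝ)) (𝓝[>] 0) := tendsto_snd
  have hsum : Tendsto (fun p : Y × ℝ => p.1 + p.2 • w) (𝓝 x ×ˢ 𝓝[>] (0 : ℝ)) (𝓝 x) := by
    simpa using (tendsto_fst (f := 𝓝 x)).add ((hsnd.mono_right nhdsWithin_le_nhds).smul_const w)
  filter_upwards [(hsum.prodMk hsnd).eventually hv, hw] with p h1 h2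
  have h : (ψ (p.1 + p.2 • (v + w)) - ψ p.1) / p.2 =
      (ψ (p.1 + p.2 • w + p.2 • v) - ψ (p.1 + p.2 • w)) / p.2
        + (ψ (p.1 + p.2 • w) - ψ p.1) / p.2 := by
    rw [← add_div, smul_add, add_assoc, add_comm (p.2 • w)]
    ring
  rw [h]
  linarith

theorem clarkeDeriv_smul_le (hψ : LocallyLipschitz ψ) (x v : Y) {s : ℝ} (hs : 0 ≤ s) :
    clarkeDeriv ψ x (s • v) ≤ s * clarkeDeriv ψ x v := by
  rcases hs.eq_or_lt with rfl | hs
  · exact clarkeDeriv_le_of_eventually_le hψ (by simp)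
  refine le_of_forall_pos_le_add fun ε hε => clarkeDeriv_le_of_eventually_le hψ ?_
  have hv := eventually_lt_of_clarkeDeriv_lt hψ (lt_add_of_pos_right (clarkeDeriv ψ x v)
    (div_pos hε hs))
  have hscale : Tendsto (fun p : Y × ℝ => s * p.2) (𝓝 x ×ˢ 𝓝[>] (0 : ℝ)) (𝓝[>] 0) := by
    have hsnd : Tendsto (fun p : Y × ℝ => p.2) (𝓝 x ×ˢ 𝓝[>] (0 : ℝ)) (𝓝[>] 0) := tendsto_snd
    refine tendsto_nhdsWithin_iff.2 ⟨?_, ?_⟩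
    · simpa using (hsnd.mono_right nhdsWithin_le_nhds).const_mul s
    · filter_upwards [hsnd self_mem_nhdsWithin] with p hp
      exact mul_pos hs hp
  filter_upwards [(tendsto_fst.prodMk hscale).eventually hv] with p h1
  have h : (ψ (p.1 + p.2 • s • v) - ψ p.1) / p.2 =
      s * ((ψ (p.1 + (s * p.2) • v) - ψ p.1) / (s * p.2)) := by
    rw [smul_smul, mul_comm p.2 s]
    field_simp
  rw [h]
  calc _ ≤ s * (clarkeDeriv ψ x v + ε / s) := by gcongr
    _ = _ := by field_simp

theorem convexOn_clarkeDeriv (hψ : LocallyLipschitz ψ) (x : Y) :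
    ConvexOn ℝ Set.univ (clarkeDeriv ψ x) := by
  refine ⟨convex_univ, fun v _ w _ a b ha hb _ => (clarkeDeriv_add_le hψ x _ _).trans ?_⟩
  exact add_le_add (clarkeDeriv_smul_le hψ x v ha) (clarkeDeriv_smul_le hψ x w hb)

theorem continuous_clarkeDeriv (hψ : LocallyLipschitz ψ) (x : Y) :
    Continuous (clarkeDeriv ψ x) := by
  obtain ⟨L, hL0, hL⟩ := exists_abs_clarkeDeriv_le hψ x
  refine (LipschitzWith.of_le_add_mul (K := ⟨L, hL0⟩) fun v w => ?_).continuous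
  have h := clarkeDeriv_add_le hψ x w (v - w)
  rw [add_sub_cancel] at h
  rw [dist_eq_norm]
  exact h.trans (by gcongr; exact (abs_le.1 (hL _)).2)

theorem eventually_clarkeDeriv_le_of_lt (hψ : LocallyLipschitz ψ) {x v : Y} {a : ℝ}
    (h : clarkeDeriv ψ x v < a) : ∀ᶠ y in 𝓝 x, clarkeDeriv ψ y v ≤ a := by
  obtain ⟨P, hP, Q, hQ, hPQ⟩ := eventually_prod_iff.1 (eventually_lt_of_clarkeDeriv_lt hψ h)
  filter_upwards [eventually_eventually_nhds.2 hP] with y hy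
  exact clarkeDeriv_le_of_eventually_le hψ
    (eventually_prod_iff.2 ⟨P, hy, Q, hQ, fun h1 _ h2 => (hPQ h1 h2).le⟩)

end Clarke

/-- A matrix game whose payoff satisfies `M i k + M k i ≤ 0` has a mixed strategy with nonpositive
payoff against every pure strategy. -/
theorem exists_mem_stdSimplex_forall_sum_mul_nonpos {ι : Type*} [Fintype ι] [Nonempty ι]
    (M : ι → ι → ℝ) (hM : ∀ i k, M i k + M k i ≤ 0) :
    ∃ s ∈ stdSimplex ℝ ι, ∀ i, ∑ k, s k * M i k ≤ 0 := by
  classical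
  let B : (ι → ℝ) →ₗ[ℝ] (ι → ℝ) →ₗ[ℝ] ℝ :=
    LinearMap.mk₂ ℝ (fun s l => ∑ i, l i * ∑ k, s k * M i k)
      (fun a b l => by simp [add_mul, mul_add, Finset.sum_add_distrib])
      (fun c a l => by simp only [Pi.smul_apply, smul_eq_mul, Finset.mul_sum]; congr! 2; ring)
      (fun s a b => by simp [add_mul, Finset.sum_add_distrib])
      (fun c s l => by simp only [Pi.smul_apply, smul_eq_mul, Finset.mul_sum]; congr! 2; ring)
  have hne : (stdSimplex ℝ ι).Nonempty := ⟨_, single_mem_stdSimplex ℝ (Classical.arbitrary ι)⟩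
  obtain ⟨a, ha, b, hb, hab⟩ := Sion.exists_isSaddlePointOn (f := fun s l => B s l)
    hne (convex_stdSimplex ℝ ι) (isCompact_stdSimplex ℝ ι)
    (fun l _ => (B.flip l).continuous_of_finiteDimensional.lowerSemicontinuous
      |>.lowerSemicontinuousOn _)
    (fun l _ => ((B.flip l).convexOn (convex_stdSimplex ℝ ι)).quasiconvexOn)
    (convex_stdSimplex ℝ ι) hne (isCompact_stdSimplex ℝ ι)
    (fun s _ => (B s).continuous_of_finiteDimensional.upperSemicontinuous.upperSemicontinuousOn _)
    (fun s _ => ((B s).concaveOn (convex_stdSimplex ℝ ι)).quasiconcaveOn)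
  refine ⟨a, ha, fun i => ?_⟩
  have h1 : B a (Pi.single i 1) ≤ B b b := hab b hb _ (single_mem_stdSimplex ℝ i)
  have h2 : B a (Pi.single i 1) = ∑ k, a k * M i k := by
    simp only [B, LinearMap.mk₂_apply]
    rw [Finset.sum_eq_single i (fun k _ hk => by rw [Pi.single_eq_of_ne hk, zero_mul])
      (fun h => absurd (Finset.mem_univ i) h), Pi.single_eq_same, one_mul]
  have h3 : B b b = ∑ i, ∑ k, b i * b k * M i k := by
    simp only [B, LinearMap.mk₂_apply, Finset.mul_sum, mul_assoc]
  have h4 : B b b = ∑ i, ∑ k, b i * b k * M k i := by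
    rw [h3, Finset.sum_comm]
    exact Finset.sum_congr rfl fun i _ => Finset.sum_congr rfl fun k _ => by rw [mul_comm (b k)]
  have h5 : B b b + B b b ≤ 0 := by
    nth_rewrite 1 [h3]
    rw [h4]
    simp only [← Finset.sum_add_distrib, ← mul_add]
    exact Finset.sum_nonpos fun i _ => Finset.sum_nonpos fun k _ =>
      mul_nonpos_of_nonneg_of_nonpos (mul_nonneg (hb.1 i) (hb.1 k)) (hM i k)
  linarith

section Reflexive

variable {X : Type*} [NormedAddCommGroup X] [NormedSpace ℝ X]

theorem Convex.isClosed_toWeakSpace_image {s : Set X} (hs : Convex ℝ s) (hc : IsClosed s) :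
    IsClosed (toWeakSpace ℝ X '' s) := by
  have h := hs.toWeakSpace_closure (𝕜 := ℝ)
  rw [hc.closure_eq] at h
  rw [h]
  exact isClosed_closure

/-- In a reflexive space, bounded closed convex sets are weakly compact. -/
theorem IsReflexive.isCompact_toWeakSpace_image (hX : IsReflexive X) {s : Set X}
    (hs : Convex ℝ s) (hc : IsClosed s) (hb : IsBounded s) :
    IsCompact (toWeakSpace ℝ X '' s) := by
  rw [← (hs.isClosed_toWeakSpace_image hc).closure_eq]
  refine NormedSpace.isCompact_closure_of_isBounded ℝ X _ ?_ fun φ _ => ?_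
  · rwa [Set.preimage_image_eq _ (toWeakSpace ℝ X).injective]
  · obtain ⟨x, hx⟩ := hX (WeakDual.toStrongDual φ)
    exact ⟨toWeakSpace ℝ X x, congrArg StrongDual.toWeakDual hx⟩

/-- Minty-type existence result for monotone bifunctions, convex in the second argument, on a closed
convex subset of a reflexive space. -/
theorem IsReflexive.exists_forall_nonpos (hX : IsReflexive X) {K : Set X} (hne : K.Nonempty)
    (hcl : IsClosed K) (hcv : Convex ℝ K) (Φ : X → X → ℝ)
    (hconv : ∀ v, ConvexOn ℝ Set.univ (Φ v)) (hcont : ∀ v, Continuous (Φ v))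
    (hmono : ∀ v w, Φ v w + Φ w v ≤ 0) (hbdd : ∀ v, IsBounded {u | Φ v u ≤ 0}) :
    ∃ u ∈ K, ∀ v ∈ K, Φ v u ≤ 0 := by
  classical
  let C : X → Set X := fun v => K ∩ {u | Φ v u ≤ 0}
  have hCcl : ∀ v, IsClosed (C v) := fun v => hcl.inter (isClosed_le (hcont v) continuous_const)
  have hCcv : ∀ v, Convex ℝ (C v) := fun v => hcv.inter (by simpa using (hconv v).convex_le 0)
  have hfin : ∀ F : Finset K, F.Nonempty → ∃ u ∈ K, ∀ v ∈ F, Φ v u ≤ 0 := by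
    intro F hF
    have : Nonempty F := hF.to_subtype
    obtain ⟨s, hs, hle⟩ := exists_mem_stdSimplex_forall_sum_mul_nonpos
      (fun i k : F => Φ (i : K) (k : K)) (fun i k => hmono _ _)
    refine ⟨∑ k, s k • ((k : K) : X),
      hcv.sum_mem (fun k _ => hs.1 k) hs.2 fun k _ => (k : K).2, fun v hv => ?_⟩
    exact ((hconv v).map_sum_le (fun k _ => hs.1 k) hs.2 fun _ _ => Set.mem_univ _).trans
      (hle ⟨v, hv⟩)
  obtain ⟨v₀, hv₀⟩ := hne
  have hcompact := hX.isCompact_toWeakSpace_image (hCcv v₀) (hCcl v₀)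
    ((hbdd v₀).subset Set.inter_subset_right)
  obtain ⟨-, ⟨u, hu, rfl⟩, hmem⟩ := hcompact.inter_iInter_nonempty
    (fun v : K => toWeakSpace ℝ X '' C v)
    (fun v => (hCcv v).isClosed_toWeakSpace_image (hCcl v)) (fun F => by
      obtain ⟨u, huK, hu⟩ := hfin (insert ⟨v₀, hv₀⟩ F) (Finset.insert_nonempty _ _)
      exact ⟨toWeakSpace ℝ X u,
        Set.mem_image_of_mem _ ⟨huK, hu ⟨v₀, hv₀⟩ (Finset.mem_insert_self _ _)⟩,
        Set.mem_iInter₂.2 fun v hv =>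
          Set.mem_image_of_mem _ ⟨huK, hu v (Finset.mem_insert_of_mem hv)⟩⟩)
  refine ⟨u, hu.1, fun v hv => ?_⟩
  obtain ⟨u', hu', heq⟩ := Set.mem_iInter.1 hmem ⟨v, hv⟩
  rw [(toWeakSpace ℝ X).injective heq] at hu'
  exact hu'.2

end Reflexive

/-- A pseudomonotone operator is lower semicontinuous along strongly convergent sequences when
tested against `uₙ - v`. -/
theorem Pseudomonotone.eventually_lt_of_tendsto {X : Type*} [NormedAddCommGroup X]
    [NormedSpace ℝ X] {A : X → X →L[ℝ] ℝ} (hA : Pseudomonotone A) {u : ℕ → X} {w : X}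
    (hu : Tendsto u atTop (𝓝 w)) (v : X) {a : ℝ} (ha : a < A w (w - v)) :
    ∀ᶠ n in atTop, a < A (u n) (u n - v) := by
  obtain ⟨R, hR⟩ := (hA.1 _ (Metric.isBounded_range_of_tendsto u hu)).exists_norm_le
  have hR : ∀ n, ‖A (u n)‖ ≤ R := fun n => hR _ ⟨_, ⟨n, rfl⟩, rfl⟩
  obtain ⟨S, hS⟩ := (Metric.isBounded_range_of_tendsto _ (hu.sub_const v)).exists_norm_le
  have hS : ∀ n, ‖u n - v‖ ≤ S := fun n => hS _ ⟨n, rfl⟩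
  have hR0 : 0 ≤ R := (norm_nonneg _).trans (hR 0)
  have h0 : Tendsto (fun n => A (u n) (u n - w)) atTop (𝓝 0) := by
    refine squeeze_zero_norm (a := fun n => R * ‖u n - w‖)
      (fun n => (A (u n)).le_of_opNorm_le (hR n) _) ?_
    simpa using ((hu.sub_const w).norm).const_mul R
  have hlim := hA.2 u w (fun g => (g.continuous.tendsto w).comp hu) h0.limsup_eq.le v
  refine eventually_lt_of_lt_liminf (ha.trans_le hlim) ⟨-(R * S), ?_⟩
  refine eventually_map.2 (Eventually.of_forall fun n => ?_)
  have h : |A (u n) (u n - v)| ≤ R * S :=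
    ((A (u n)).le_of_opNorm_le (hR n) _).trans (by gcongr; exact hS n)
  exact (abs_le.1 h).1

/-- under (A1), (A3), (A4), (A6), (A7)' and (A8), the constrained
hemivariational inequality has a unique solution `u ∈ K`. -/
theorem hvi_exists_unique
    {X Xj : Type*}
    [NormedAddCommGroup X] [NormedSpace ℝ X] [CompleteSpace X]
    [NormedAddCommGroup Xj] [NormedSpace ℝ Xj] [CompleteSpace Xj]
    -- (A1)
    (hrefl : IsReflexive X)
    (K : Set X) (hKne : K.Nonempty) (hKcl : IsClosed K) (hKcv : Convex ℝ K)
    -- (A3)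
    (γj : X →L[ℝ] Xj) (cj : ℝ) (hcj : 0 < cj) (hγj : ∀ v : X, ‖γj v‖ ≤ cj * ‖v‖)
    -- (A4)
    (A : X → X →L[ℝ] ℝ) (hA : Pseudomonotone A)
    (mA : ℝ) (hmA : 0 < mA)
    (hAsm : ∀ v₁ v₂ : X, mA * ‖v₁ - v₂‖ ^ 2 ≤ (A v₁ - A v₂) (v₁ - v₂))
    -- (A6)
    (j : Xj → ℝ) (hj : LocallyLipschitz j)
    (c₀ c₁ : ℝ) (hc₀ : 0 ≤ c₀) (hc₁ : 0 ≤ c₁)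
    (hjsub : ∀ (z : Xj), ∀ ζ ∈ clarkeSubdiff j z, ‖ζ‖ ≤ c₀ + c₁ * ‖z‖)
    (αj : ℝ) (hαj : 0 ≤ αj)
    (hj2 : ∀ z₁ z₂ : Xj,
      clarkeDeriv j z₁ (z₂ - z₁) + clarkeDeriv j z₂ (z₁ - z₂) ≤ αj * ‖z₁ - z₂‖ ^ 2)
    -- (A7)'
    (hsmall : αj * cj ^ 2 < mA)
    -- (A8)
    (f : X →L[ℝ] ℝ) :
    ∃! u : X, u ∈ K ∧ ∀ v ∈ K,
      f (v - u) ≤ A u (v - u) + clarkeDeriv j (γj u) (γj v - γj u) := by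
  set m : ℝ := (mA - αj * cj ^ 2) / 2 with hm
  have hm0 : 0 < m := by rw [hm]; linarith
  have hmono : ∀ v w : X,
      A v (w - v) + clarkeDeriv j (γj v) (γj w - γj v) +
        (A w (v - w) + clarkeDeriv j (γj w) (γj v - γj w)) ≤ -(2 * m * ‖w - v‖ ^ 2) := by
    intro v w
    have h1 := hAsm w v
    have h2 := hj2 (γj w) (γj v)
    have h3 : ‖γj w - γj v‖ ^ 2 ≤ cj ^ 2 * ‖w - v‖ ^ 2 := by
      rw [← map_sub, ← mul_pow]
      exact pow_le_pow_left₀ (norm_nonneg _) (hγj _) 2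
    have h4 := mul_le_mul_of_nonneg_left h3 hαj
    have h5 : A w (v - w) = -A w (w - v) := by rw [← map_neg, neg_sub]
    rw [sub_apply] at h1
    rw [h5, hm]
    linarith
  let h : X → X → ℝ := fun v d =>
    (A v - f) d + clarkeDeriv j (γj v) (γj d) + m * ‖d‖ ^ 2
  have hconv : ∀ v, ConvexOn ℝ Set.univ (h v) := fun v =>
    (((A v - f).toLinearMap.convexOn convex_univ).add
      ((convexOn_clarkeDeriv hj (γj v)).comp_linearMap γj.toLinearMap)).add
      ((convexOn_univ_norm.pow (fun _ _ => norm_nonneg _) 2).smul hm0.le)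
  have hcont : ∀ v, Continuous (h v) := fun v =>
    ((A v - f).continuous.add ((continuous_clarkeDeriv hj (γj v)).comp γj.continuous)).add
      (continuous_const.mul (continuous_norm.pow 2))
  have hbdd : ∀ v, IsBounded {u | h v (u - v) ≤ 0} := by
    intro v
    obtain ⟨L, hL0, hL⟩ := exists_abs_clarkeDeriv_le hj (γj v)
    refine (Metric.isBounded_closedBall (x := v)
      (r := (‖A v - f‖ + L * cj) / m)).subset fun u hu => ?_
    rw [Metric.mem_closedBall, dist_eq_norm, le_div_iff₀ hm0]
    have h1 := (abs_le.1 ((A v - f).le_opNorm (u - v))).1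
    have h2 := (abs_le.1 (hL (γj (u - v)))).1
    have h3 := mul_le_mul_of_nonneg_left (hγj (u - v)) hL0
    have h4 : (A v - f) (u - v) + clarkeDeriv j (γj v) (γj (u - v)) + m * ‖u - v‖ ^ 2 ≤ 0 := hu
    rcases (norm_nonneg (u - v)).eq_or_lt with h0 | h0
    · rw [← h0, zero_mul]
      exact add_nonneg (norm_nonneg _) (mul_nonneg hL0 hcj.le)
    · refine le_of_mul_le_mul_right ?_ h0
      linarith
  obtain ⟨u, huK, hu⟩ := hrefl.exists_forall_nonpos hKne hKcl hKcv (fun v u => h v (u - v))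
    (fun v => by
      simpa [Function.comp_def, sub_eq_add_neg] using (hconv v).translate_left (-v))
    (fun v => (hcont v).comp (continuous_id.sub continuous_const))
    (fun v w => by
      have h1 := hmono v w
      have h2 : f (w - v) = -f (v - w) := by rw [← map_neg, neg_sub]
      simp only [h, sub_apply, map_sub γj, norm_sub_rev v w]
      linarith) hbdd
  have hsol : ∀ v ∈ K, f (v - u) ≤ A u (v - u) + clarkeDeriv j (γj u) (γj v - γj u) := by
    intro v hv
    refine le_of_forall_pos_le_add fun ε hε => ?_
    let t : ℕ → ℝ := fun n => 1 / ((n : ℝ) + 1)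
    have ht0 : ∀ n, 0 < t n := fun n => Nat.one_div_pos_of_nat
    have ht1 : ∀ n, t n ≤ 1 := fun n => by
      simpa [t] using Nat.one_div_le_one_div (α := ℝ) (Nat.zero_le n)
    have ht : Tendsto t atTop (𝓝 0) := tendsto_one_div_add_atTop_nhds_zero_nat
    let w : ℕ → X := fun n => u + t n • (v - u)
    have hw : Tendsto w atTop (𝓝 u) := by
      simpa using (ht.smul_const (v - u)).const_add u
    have hwK : ∀ n, w n ∈ K := fun n => hKcv.add_smul_sub_mem huK hv ⟨(ht0 n).le, ht1 n⟩
    have hminty : ∀ n, f (v - u) ≤ A (w n) (v - u) + clarkeDeriv j (γj (w n)) (γj (v - u)) := by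
      intro n
      have h1 : h (w n) (u - w n) ≤ 0 := hu (w n) (hwK n)
      have h2 : u - w n = -(t n • (v - u)) := by simp [w]
      have h3 := clarkeDeriv_add_le hj (γj (w n)) (t n • γj (v - u)) (-(t n • γj (v - u)))
      have h4 := clarkeDeriv_smul_le hj (γj (w n)) (γj (v - u)) (ht0 n).le
      have h5 : clarkeDeriv j (γj (w n)) 0 = 0 := by
        obtain ⟨L, -, hL⟩ := exists_abs_clarkeDeriv_le hj (γj (w n))
        simpa using hL 0
      have h6 : 0 ≤ m * ‖u - w n‖ ^ 2 := by positivity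
      rw [add_neg_cancel, h5] at h3
      simp only [h] at h1
      rw [h2] at h1 h6
      simp only [map_neg, map_smul, sub_apply, smul_eq_mul] at h1
      refine le_of_mul_le_mul_left ?_ (ht0 n)
      linarith
    have hlim : Tendsto
        (fun n => (1 - t n) * (f (v - u) - clarkeDeriv j (γj u) (γj (v - u)) - ε / 2)) atTop
        (𝓝 (f (v - u) - clarkeDeriv j (γj u) (γj (v - u)) - ε / 2)) := by
      simpa using (ht.const_sub 1).mul_const
        (f (v - u) - clarkeDeriv j (γj u) (γj (v - u)) - ε / 2)
    have hle : f (v - u) - clarkeDeriv j (γj u) (γj (v - u)) - ε / 2 ≤ A u (v - u) + ε / 2 := by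
      refine le_of_tendsto hlim ?_
      have hclarke := ((γj.continuous.tendsto u).comp hw).eventually
        (eventually_clarkeDeriv_le_of_lt hj
          (lt_add_of_pos_right (clarkeDeriv j (γj u) (γj (v - u))) (half_pos hε)))
      filter_upwards [hclarke, hA.eventually_lt_of_tendsto hw v
        (sub_lt_self (A u (u - v)) (half_pos hε))] with n h1 h2
      have h3 : w n - v = -((1 - t n) • (v - u)) := by
        simp only [w, sub_smul, one_smul]
        abel
      have h4 : A u (u - v) = -A u (v - u) := by rw [← map_neg, neg_sub]
      rw [h3, map_neg, map_smul, smul_eq_mul, h4] at h2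
      have h5 := mul_le_mul_of_nonneg_left (a := 1 - t n)
        (b := f (v - u) - clarkeDeriv j (γj u) (γj (v - u)) - ε / 2) (c := A (w n) (v - u))
        (by linarith [hminty n, show clarkeDeriv j (γj (w n)) (γj (v - u)) ≤ _ from h1])
        (sub_nonneg.2 (ht1 n))
      linarith
    rw [← map_sub γj]
    linarith
  refine ⟨u, ⟨huK, hsol⟩, fun u' ⟨hu'K, hu'⟩ => ?_⟩
  have h1 := hu' u huK
  have h2 := hsol u' hu'K
  have h3 := hmono u u'
  have h4 : f (u' - u) = -f (u - u') := by rw [← map_neg, neg_sub]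
  have h5 : m * ‖u' - u‖ ^ 2 ≤ 0 := by linarith
  have h6 : ‖u' - u‖ ^ 2 ≤ 0 := nonpos_of_mul_nonpos_right h5 hm0
  exact sub_eq_zero.1 (norm_eq_zero.1 (pow_eq_zero_iff two_ne_zero |>.1
    (h6.antisymm (sq_nonneg _))))
end
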